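/- Let G be a finite simple graph with a hole cover C satisfying the NC property. Then ω(Ĝ(C)) ≤ ω(G) + 1, where ω denotes the clique number. Furthermore, equality holds if and only if there exists a vertex u ∈ C such that the set ((⋃_{H a hole of G containing u} V(H)) ∪ N_G(u)) \ {u} contains a maximum clique of G. -/

import Mathlib

open SimpleGraph

variable {V : Type*}

/-- A *hole* of `G`: an induced cycle of length at least 4, given as a closed walk. -/
def IsHole (G : SimpleGraph V) {a : V} (w : G.Walk a a) : Prop :=
  w.IsCycle ∧ 4 ≤ w.length ∧
    ∀ x y : V, x ∈ w.support → y ∈ w.support → G.Adj x y → s(x, y) ∈ w.edges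

/-- A graph is *chordal* if it has no hole. -/
def IsChordal (G : SimpleGraph V) : Prop :=
  ∀ (a : V) (w : G.Walk a a), ¬ IsHole G w

/-- Two edge lists share two consecutive edges. -/
def ShareTwoConsecutiveEdges (l₁ l₂ : List (Sym2 V)) : Prop :=
  ∃ x y z : V, x ≠ z ∧ s(x, y) ∈ l₁ ∧ s(y, z) ∈ l₁ ∧ s(x, y) ∈ l₂ ∧ s(y, z) ∈ l₂

/-- A vertex `u` satisfies the *NC property* in `G`: no hole through `u` and
no hole avoiding `u` share two consecutive edges. -/
def VertexNC (G : SimpleGraph V) (u : V) : Prop :=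
  ∀ (a b : V) (w₁ : G.Walk a a) (w₂ : G.Walk b b),
    IsHole G w₁ → IsHole G w₂ → u ∈ w₁.support → u ∉ w₂.support →
      ¬ ShareTwoConsecutiveEdges w₁.edges w₂.edges

/-- A *hole cover* of `G`: a nonempty vertex set meeting every hole of `G`. -/
def IsHoleCover (G : SimpleGraph V) (C : Set V) : Prop :=
  C.Nonempty ∧ ∀ (a : V) (w : G.Walk a a), IsHole G w → ∃ u ∈ C, u ∈ w.support

/-- A vertex set `C` satisfies the *NC property* in `G`: every vertex of `C`
satisfies the NC property and every hole of `G` contains at most one vertex of `C`. -/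
def SetNC (G : SimpleGraph V) (C : Set V) : Prop :=
  (∀ u ∈ C, VertexNC G u) ∧
    ∀ (a : V) (w : G.Walk a a), IsHole G w →
      ∀ u ∈ C, ∀ v ∈ C, u ∈ w.support → v ∈ w.support → u = v

/-- A graph satisfies the *NC property* if it has a hole cover satisfying the NC property. -/
def HasNCProperty (G : SimpleGraph V) : Prop :=
  ∃ C : Set V, IsHoleCover G C ∧ SetNC G C

/-- A DP-cover of `G` with lists of size `k`, realized on the vertex set `V × Fin k`:
the fibers `{v} × Fin k` are cliques, cross edges exist only over edges of `G`,
and the edges between two fibers form a matching. -/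
def IsDPCover (G : SimpleGraph V) (k : ℕ) (H : SimpleGraph (V × Fin k)) : Prop :=
  (∀ (v : V) (i j : Fin k), i ≠ j → H.Adj (v, i) (v, j)) ∧
  (∀ (u v : V) (i j : Fin k), u ≠ v → H.Adj (u, i) (v, j) → G.Adj u v) ∧
  (∀ (u v : V) (i j j' : Fin k), u ≠ v → H.Adj (u, i) (v, j) → H.Adj (u, i) (v, j') → j = j')

/-- `G` is DP-`k`-colorable: every DP-cover with lists of size `k` admits an
independent transversal. -/
def DPColorable (G : SimpleGraph V) (k : ℕ) : Prop :=
  ∀ H : SimpleGraph (V × Fin k), IsDPCover G k H →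
    ∃ f : V → Fin k, ∀ u v : V, ¬ H.Adj (u, f u) (v, f v)

/-- The DP-chromatic number: the least `k` such that `G` is DP-`k`-colorable. -/
noncomputable def dpChromaticNumber (G : SimpleGraph V) : ℕ :=
  sInf {k | DPColorable G k}

/-- `M` is a minor of `G`, via the branch-set characterization. -/
def HasMinor {W : Type*} (G : SimpleGraph V) (M : SimpleGraph W) : Prop :=
  ∃ B : W → Set V,
    (∀ i, (B i).Nonempty) ∧
    (∀ i, (G.induce (B i)).Connected) ∧
    (Pairwise fun i j => Disjoint (B i) (B j)) ∧
    ∀ i j, M.Adj i j → ∃ a ∈ B i, ∃ b ∈ B j, G.Adj a b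

/-- Locally chordalize by `u` all holes of `G` containing `u`: add all edges
joining `u` to the vertices of such holes (new edges go to the vertices
nonadjacent to `u`). -/
def localChordalize (G : SimpleGraph V) (u : V) : SimpleGraph V :=
  G ⊔ SimpleGraph.fromRel fun x y =>
    x = u ∧ ∃ (a : V) (w : G.Walk a a), IsHole G w ∧ u ∈ w.support ∧ y ∈ w.support

/-- Recursive local chordalizations along a list of vertices. -/
def chordalizeList (G : SimpleGraph V) : List V → SimpleGraph V
  | [] => G
  | u :: l => chordalizeList (localChordalize G u) l

/-- Delete a vertex set (keeping the ambient vertex type: the removed vertices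
become isolated). -/
def removeVerts (G : SimpleGraph V) (A : Set V) : SimpleGraph V where
  Adj x y := G.Adj x y ∧ x ∉ A ∧ y ∉ A
  symm := by constructor; intro x y h; exact ⟨h.1.symm, h.2.2, h.2.1⟩
  loopless := by constructor; intro x h; exact G.loopless.irrefl x h.1

/-- The chordalization chain corresponding to an ordered partition
`parts 0, …, parts (k-1)` (playing the role of `C₁, …, C_k`) of a hole cover:
`(lcChain G parts i).1 = Gᵢ` and `(lcChain G parts i).2 = Gᵢ*`. -/
def lcChain (G : SimpleGraph V) {k : ℕ} (parts : Fin k → List V) :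
    ℕ → SimpleGraph V × SimpleGraph V
  | 0 =>
      (removeVerts G {v | ∃ i, v ∈ parts i}, removeVerts G {v | ∃ i, v ∈ parts i})
  | i + 1 =>
      let Gi := (lcChain G parts i).2 ⊔
        removeVerts G {v | ∃ j : Fin k, i + 1 ≤ (j : ℕ) ∧ v ∈ parts j}
      (Gi, if h : i < k then chordalizeList Gi (parts ⟨i, h⟩) else Gi)

/-- `(parts 0, …, parts (k-1))` is a *local chordalization partition* of the hole
cover `C` of `G`. -/
def IsLCPartition (G : SimpleGraph V) (C : Set V) {k : ℕ} (parts : Fin k → List V) : Prop :=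
  (∀ i, (parts i).Nodup) ∧
  (∀ i, parts i ≠ []) ∧
  (Pairwise fun i j : Fin k => ∀ v, v ∈ parts i → v ∉ parts j) ∧
  {v | ∃ i, v ∈ parts i} = C ∧
  ∀ i : Fin k,
    IsHoleCover (lcChain G parts ((i : ℕ) + 1)).1 {v | v ∈ parts i} ∧
    SetNC (lcChain G parts ((i : ℕ) + 1)).1 {v | v ∈ parts i} ∧
    IsChordal (lcChain G parts ((i : ℕ) + 1)).2

/-- The *non-chordality index* of `G`. -/
noncomputable def ncIndex (G : SimpleGraph V) : ℕ := by
  classical exact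
    if IsChordal G then 0
    else sInf {k | ∃ (C : Set V) (parts : Fin k → List V),
      IsHoleCover G C ∧ IsLCPartition G C parts}

/-- `G` is `k`-list-colorable. -/
def ListColorable (G : SimpleGraph V) (k : ℕ) : Prop :=
  ∀ L : V → Finset ℕ, (∀ v, k ≤ (L v).card) →
    ∃ f : V → ℕ, (∀ v, f v ∈ L v) ∧ ∀ u v : V, G.Adj u v → f u ≠ f v

/-- The list chromatic number of `G`. -/
noncomputable def listChromaticNumber (G : SimpleGraph V) : ℕ :=
  sInf {k | ListColorable G k}

/-! ### Helper lemmas -/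

/-- `x` and `y` are joined by a walk inside `S`. -/
def ConnIn (G : SimpleGraph V) (S : Set V) (x y : V) : Prop :=
  ∃ P : G.Walk x y, ∀ z ∈ P.support, z ∈ S

lemma ConnIn.refl {G : SimpleGraph V} {S : Set V} {x : V} (hx : x ∈ S) : ConnIn G S x x :=
  ⟨Walk.nil, by simpa using hx⟩

lemma ConnIn.symm {G : SimpleGraph V} {S : Set V} {x y : V} (h : ConnIn G S x y) :
    ConnIn G S y x := by
  obtain ⟨P, hP⟩ := h
  exact ⟨P.reverse, by simpa using hP⟩

lemma ConnIn.trans {G : SimpleGraph V} {S : Set V} {x y z : V} (h : ConnIn G S x y)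
    (h' : ConnIn G S y z) : ConnIn G S x z := by
  obtain ⟨P, hP⟩ := h
  obtain ⟨Q, hQ⟩ := h'
  refine ⟨P.append Q, fun t ht => ?_⟩
  rw [Walk.mem_support_append_iff] at ht
  exact ht.elim (hP t) (hQ t)

lemma ConnIn.mono {G : SimpleGraph V} {S T : Set V} {x y : V} (h : ConnIn G S x y)
    (hST : S ⊆ T) : ConnIn G T x y := by
  obtain ⟨P, hP⟩ := h
  exact ⟨P, fun z hz => hST (hP z hz)⟩

lemma ConnIn.of_adj {G : SimpleGraph V} {S : Set V} {x y : V} (hx : x ∈ S) (hy : y ∈ S)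
    (h : G.Adj x y) : ConnIn G S x y :=
  ⟨Walk.cons h Walk.nil, by simp [hx, hy]⟩

lemma ConnIn.of_touch {G : SimpleGraph V} {S : Set V} {x y : V} (hx : x ∈ S) (hy : y ∈ S)
    (h : x = y ∨ G.Adj x y) : ConnIn G S x y := by
  rcases h with rfl | h
  · exact ConnIn.refl hx
  · exact ConnIn.of_adj hx hy h

/-- Building a hole through `b` from a connection of two nonadjacent neighbours. -/
lemma exists_hole {G : SimpleGraph V} {S : Set V} {b p q : V} (hbp : G.Adj b p)
    (hqb : G.Adj q b) (hpq : p ≠ q) (hnpq : ¬ G.Adj p q) (hbS : b ∉ S)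
    (hN : ∀ x ∈ S, G.Adj b x → x = p ∨ x = q) (hc : ConnIn G S p q) :
    ∃ P : G.Walk p q, (∀ z ∈ P.support, z ∈ S) ∧
      IsHole G (Walk.cons hbp (P.concat hqb)) := by
  classical
  have hex : ∃ n, ∃ P : G.Walk p q, (∀ z ∈ P.support, z ∈ S) ∧ P.length = n := by
    obtain ⟨P, hP⟩ := hc
    exact ⟨_, P, hP, rfl⟩
  obtain ⟨P0, hP0, hl0⟩ := Nat.find_spec hex
  have hmin : ∀ Q : G.Walk p q, (∀ z ∈ Q.support, z ∈ S) → Nat.find hex ≤ Q.length :=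
    fun Q hQ => Nat.find_min' hex ⟨Q, hQ, rfl⟩
  rw [← hl0] at hmin
  set P := P0.bypass with hPdef
  have hPS : ∀ z ∈ P.support, z ∈ S := fun z hz => hP0 z (P0.support_bypass_subset_support hz)
  have hPp : P.IsPath := P0.bypass_isPath
  have hPmin : ∀ Q : G.Walk p q, (∀ z ∈ Q.support, z ∈ S) → P.length ≤ Q.length :=
    fun Q hQ => (P0.length_bypass_le_length).trans (hmin Q hQ)
  have hbP : b ∉ P.support := fun h => hbS (hPS b h)
  have hlen : 2 ≤ P.length := by
    by_contra hlt
    have h0 : P.getVert 0 = p := P.getVert_zero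
    have h1 : P.getVert P.length = q := P.getVert_length
    have : P.length = 0 ∨ P.length = 1 := by omega
    rcases this with h | h
    · rw [h] at h1; exact hpq (h0.symm.trans h1)
    · have := P.adj_getVert_succ (i := 0) (by omega)
      rw [h] at h1
      rw [h0, Nat.zero_add, h1] at this
      exact hnpq this
  -- induced
  have key : ∀ i j, i < j → j ≤ P.length → G.Adj (P.getVert i) (P.getVert j) →
      s(P.getVert i, P.getVert j) ∈ P.edges := by
    intro i j hij hj hadj
    have h1 := hPmin ((P.take i).append (Walk.cons hadj (P.drop j))) (by
      intro z hz
      rw [Walk.mem_support_append_iff, Walk.support_cons, List.mem_cons] at hz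
      rcases hz with hz | hz | hz
      · exact hPS z ((P.isSubwalk_take i).support_subset hz)
      · exact hPS z (hz ▸ P.getVert_mem_support i)
      · exact hPS z ((P.isSubwalk_drop j).support_subset hz))
    rw [Walk.length_append, Walk.length_cons, Walk.take_length, Walk.drop_length] at h1
    have : j = i + 1 := by omega
    subst this
    exact P.mk_mem_edges_iff_exists.2 ⟨i, by omega, rfl⟩
  have key2 : ∀ x y, x ∈ P.support → y ∈ P.support → G.Adj x y → s(x, y) ∈ P.edges := by
    intro x y hx hy hadj
    obtain ⟨i, rfl, hi⟩ := Walk.mem_support_iff_exists_getVert.1 hx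
    obtain ⟨j, rfl, hj⟩ := Walk.mem_support_iff_exists_getVert.1 hy
    rcases lt_trichotomy i j with h | h | h
    · exact key i j h hj hadj
    · subst h; exact absurd hadj (G.irrefl)
    · rw [Sym2.eq_swap]; exact key j i h hi hadj.symm
  have keyb : ∀ y, y ∈ P.support → G.Adj b y →
      s(b, y) ∈ (Walk.cons hbp (P.concat hqb)).edges := by
    intro y hy hadj
    rcases hN y (hPS y hy) hadj with rfl | rfl
    · simp
    · simp [Walk.edges_concat, Sym2.eq_swap]
  have hsup : ∀ x, x ∈ (Walk.cons hbp (P.concat hqb)).support → x = b ∨ x ∈ P.support := by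
    intro x hx
    simp only [Walk.support_cons, Walk.support_concat, List.mem_cons,
      List.mem_append, List.not_mem_nil, or_false] at hx
    tauto
  refine ⟨P, hPS, ?_, ?_, ?_⟩
  · rw [Walk.cons_isCycle_iff]
    refine ⟨hPp.concat hbP hqb, ?_⟩
    intro h
    simp only [Walk.edges_concat, List.concat_eq_append, List.mem_append, List.mem_singleton] at h
    rcases h with h | h
    · exact hbP (P.fst_mem_support_of_mem_edges h)
    · rw [Sym2.eq_swap] at h
      have := Sym2.congr_left.1 h
      exact hpq this
  · rw [Walk.length_cons, Walk.length_concat]; omega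
  · intro x y hx hy hadj
    rcases hsup x hx with hxb | hxP <;> rcases hsup y hy with hyb | hyP
    · rw [hxb, hyb] at hadj; exact absurd hadj (G.irrefl)
    · rw [hxb] at hadj ⊢; exact keyb y hyP hadj
    · rw [hyb] at hadj ⊢; rw [Sym2.eq_swap]; exact keyb x hxP hadj.symm
    · have := key2 x y hxP hyP hadj
      simp [Walk.edges_concat, this]

/-- Indexing of a hole starting from a given vertex. -/
lemma hole_index {G : SimpleGraph V} {a u : V} {w : G.Walk a a} (hw : IsHole G w)
    (hu : u ∈ w.support) :
    ∃ (n : ℕ) (c : ℕ → V), 4 ≤ n ∧ c 0 = u ∧ c n = u ∧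
      (∀ i < n, G.Adj (c i) (c (i + 1))) ∧
      (∀ i < n, s(c i, c (i + 1)) ∈ w.edges) ∧
      (∀ i j, i < n → j < n → c i = c j → i = j) ∧
      (∀ x, x ∈ w.support ↔ ∃ i < n, c i = x) ∧
      (∀ i j, i < j → j < n → G.Adj (c i) (c j) → j = i + 1 ∨ (i = 0 ∧ j = n - 1)) := by
  classical
  obtain ⟨hcyc, hlen, hind⟩ := hw
  set w' := w.rotate u hu with hw'
  have hcyc' : w'.IsCycle := by simpa [hw'] using hcyc
  have hlen' : w'.length = w.length := by simp [hw']
  have hedg : ∀ e, e ∈ w'.edges ↔ e ∈ w.edges := fun e => (w.rotate_edges u hu).mem_iff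
  have hinj : ∀ i j, i < w'.length → j < w'.length → w'.getVert i = w'.getVert j → i = j := by
    intro i j hi hj h
    exact hcyc'.getVert_injOn' (by simp; omega) (by simp; omega) h
  have h0 : w'.getVert 0 = u := w'.getVert_zero
  have hn : w'.getVert w'.length = u := w'.getVert_length
  have hsup : ∀ x, x ∈ w.support ↔ x ∈ w'.support := by
    intro x
    rw [hw', Walk.mem_support_rotate_iff]
  refine ⟨w'.length, w'.getVert, by omega, h0, hn, ?_, ?_, hinj, ?_, ?_⟩
  · intro i hi; exact w'.adj_getVert_succ hi
  · intro i hi; exact (hedg _).1 (w'.mk_mem_edges_iff_exists.2 ⟨i, hi, rfl⟩)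
  · intro x
    rw [hsup, Walk.mem_support_iff_exists_getVert]
    constructor
    · rintro ⟨i, rfl, hi⟩
      rcases hi.lt_or_eq with h | h
      · exact ⟨i, h, rfl⟩
      · exact ⟨0, by omega, by rw [h0, h, hn]⟩
    · rintro ⟨i, hi, rfl⟩
      exact ⟨i, rfl, hi.le⟩
  · intro i j hij hj hadj
    have he := hind _ _ ((hsup _).2 (w'.getVert_mem_support i))
      ((hsup _).2 (w'.getVert_mem_support j)) hadj
    rw [← hedg, Walk.mk_mem_edges_iff_exists] at he
    obtain ⟨k, hk, he⟩ := he
    have hk1 : k + 1 < w'.length ∨ k + 1 = w'.length := by omega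
    rw [Sym2.eq_iff] at he
    rcases hk1 with hk1 | hk1
    · rcases he with ⟨h1, h2⟩ | ⟨h1, h2⟩
      · have := hinj _ _ hk (by omega) h1
        have := hinj _ _ hk1 hj h2
        omega
      · have := hinj _ _ hk hj h1
        have := hinj _ _ hk1 (by omega) h2
        omega
    · rw [hk1, hn.trans h0.symm] at he
      rcases he with ⟨h1, h2⟩ | ⟨h1, h2⟩
      · have := hinj _ _ (by omega) hj h2
        omega
      · have := hinj _ _ hk hj h1
        have := hinj _ _ (by omega) (by omega) h2
        omega

lemma connIn_interval {G : SimpleGraph V} {S : Set V} (c : ℕ → V) (n : ℕ)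
    (hadj : ∀ i < n, G.Adj (c i) (c (i + 1))) (i j : ℕ) (hij : i ≤ j) (hj : j ≤ n)
    (hS : ∀ k, i ≤ k → k ≤ j → c k ∈ S) : ConnIn G S (c i) (c j) := by
  induction j, hij using Nat.le_induction with
  | base => exact ConnIn.refl (hS i le_rfl le_rfl)
  | succ j hij ih =>
    exact (ih (by omega) (fun k h1 h2 => hS k h1 (by omega))).trans
      (ConnIn.of_adj (hS j hij (by omega)) (hS (j + 1) (by omega) le_rfl) (hadj j (by omega)))

/-- `L` is the interior of an arc from `u` to `b`, with `p` next to `u` and `q` next to `b`. -/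
structure IsSide (G : SimpleGraph V) (u b p q : V) (L : Set V) : Prop where
  up : G.Adj u p
  qb : G.Adj q b
  hp : p ∈ L
  hq : q ∈ L
  hu : u ∉ L
  hb : b ∉ L
  nu : ∀ x ∈ L, G.Adj u x → x = p
  nb : ∀ x ∈ L, G.Adj b x → x = q
  conn : ∀ x ∈ L, ConnIn G L p x

lemma hole_split {G : SimpleGraph V} {a u b : V} {w : G.Walk a a} (hw : IsHole G w)
    (hu : u ∈ w.support) (hb : b ∈ w.support) (hub : u ≠ b) (hnub : ¬ G.Adj u b) :
    ∃ L R p q p' q', IsSide G u b p q L ∧ IsSide G u b p' q' R ∧ q ≠ q' ∧ ¬ G.Adj q q' ∧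
      s(q, b) ∈ w.edges ∧ s(b, q') ∈ w.edges := by
  obtain ⟨n, c, hn, h0, hcn, hadj, hedge, hinj, hsup, hind⟩ := hole_index hw hu
  obtain ⟨m, hm, rfl⟩ := (hsup b).1 hb
  have hm0 : m ≠ 0 := by rintro rfl; exact hub h0.symm
  have hm1 : m ≠ 1 := by
    rintro rfl; apply hnub; rw [← h0]; exact hadj 0 (by omega)
  have hmn : m ≠ n - 1 := by
    intro h
    have := hadj m hm
    rw [show m + 1 = n by omega, hcn] at this
    exact hnub this.symm
  have hlast : G.Adj (c 0) (c (n - 1)) := by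
    have := hadj (n - 1) (by omega)
    rw [show n - 1 + 1 = n by omega, hcn, ← h0] at this
    exact this.symm
  have hm' : m - 1 + 1 = m := by omega
  subst h0
  refine ⟨{x | ∃ i, 0 < i ∧ i < m ∧ c i = x}, {x | ∃ i, m < i ∧ i < n ∧ c i = x},
    c 1, c (m - 1), c (n - 1), c (m + 1), ?_, ?_, ?_, ?_, ?_, ?_⟩
  · refine ⟨hadj 0 (by omega), ?_, ⟨1, by omega, by omega, rfl⟩,
      ⟨m - 1, by omega, by omega, rfl⟩, ?_, ?_, ?_, ?_, ?_⟩
    · have := hadj (m - 1) (by omega)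
      rwa [hm'] at this
    · rintro ⟨i, h1, h2, h3⟩
      have := hinj _ _ (by omega) (by omega) h3
      omega
    · rintro ⟨i, h1, h2, h3⟩
      have := hinj _ _ (by omega) (by omega) h3
      omega
    · rintro _ ⟨i, h1, h2, rfl⟩ h
      have := hind 0 i h1 (by omega) h
      congr 1; omega
    · rintro _ ⟨i, h1, h2, rfl⟩ h
      have := hind i m h2 (by omega) h.symm
      congr 1; omega
    · rintro _ ⟨i, h1, h2, rfl⟩
      exact connIn_interval c n hadj 1 i (by omega) (by omega)
        (fun k hk1 hk2 => ⟨k, by omega, by omega, rfl⟩)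
  · refine ⟨hlast, (hadj m hm).symm, ⟨n - 1, by omega, by omega, rfl⟩,
      ⟨m + 1, by omega, by omega, rfl⟩, ?_, ?_, ?_, ?_, ?_⟩
    · rintro ⟨i, h1, h2, h3⟩
      have := hinj _ _ (by omega) (by omega) h3
      omega
    · rintro ⟨i, h1, h2, h3⟩
      have := hinj _ _ (by omega) (by omega) h3
      omega
    · rintro _ ⟨i, h1, h2, rfl⟩ h
      have := hind 0 i (by omega) (by omega) h
      congr 1; omega
    · rintro _ ⟨i, h1, h2, rfl⟩ h
      have := hind m i h1 (by omega) h
      congr 1; omega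
    · rintro _ ⟨i, h1, h2, rfl⟩
      apply ConnIn.symm
      exact connIn_interval c n hadj i (n - 1) (by omega) (by omega)
        (fun k hk1 hk2 => ⟨k, by omega, by omega, rfl⟩)
  · intro h
    have := hinj _ _ (by omega) (by omega) h
    omega
  · intro h
    have := hind (m - 1) (m + 1) (by omega) (by omega) h
    omega
  · have := hedge (m - 1) (by omega)
    rwa [hm'] at this
  · exact hedge m hm

/-- A connected set missing `b` cannot touch both sides of a hole through `u`. -/
lemma misses_side {G : SimpleGraph V} {a u b : V} {w : G.Walk a a} (hNC : VertexNC G u)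
    (hw : IsHole G w) (hu : u ∈ w.support) {L R : Set V} {p q p' q' : V}
    (hL : IsSide G u b p q L) (hR : IsSide G u b p' q' R) (hqq : q ≠ q') (hnqq : ¬ G.Adj q q')
    (he : s(q, b) ∈ w.edges) (he' : s(b, q') ∈ w.edges) (hub : u ≠ b)
    {Y : Set V} {y : V} (hY : ∀ x ∈ Y, ConnIn G Y y x) (huY : u ∉ Y)
    (hbY : ∀ x ∈ Y, x ≠ b ∧ ¬ G.Adj b x)
    (tL : ∃ x ∈ L, ∃ z ∈ Y, x = z ∨ G.Adj x z)
    (tR : ∃ x ∈ R, ∃ z ∈ Y, x = z ∨ G.Adj x z) : False := by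
  obtain ⟨x, hx, z, hz, hxz⟩ := tL
  obtain ⟨x', hx', z', hz', hxz'⟩ := tR
  have sL : L ⊆ L ∪ R ∪ Y := fun t ht => Or.inl (Or.inl ht)
  have sR : R ⊆ L ∪ R ∪ Y := fun t ht => Or.inl (Or.inr ht)
  have sY : Y ⊆ L ∪ R ∪ Y := fun t ht => Or.inr ht
  have hc : ConnIn G (L ∪ R ∪ Y) q q' :=
    ((((((hL.conn q hL.hq).symm.trans (hL.conn x hx)).mono sL).trans
      (ConnIn.of_touch (sL hx) (sY hz) hxz)).trans
      (((hY z hz).symm.trans (hY z' hz')).mono sY)).trans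
      (ConnIn.of_touch (sR hx') (sY hz') hxz').symm).trans
      (((hR.conn x' hx').symm.trans (hR.conn q' hR.hq)).mono sR)
  obtain ⟨P, hP, hole⟩ := exists_hole (S := L ∪ R ∪ Y) hL.qb.symm hR.qb hqq hnqq
    (by
      rintro ((h | h) | h)
      · exact hL.hb h
      · exact hR.hb h
      · exact (hbY b h).1 rfl)
    (by
      rintro t ((h | h) | h) hadj
      · exact Or.inl (hL.nb t h hadj)
      · exact Or.inr (hR.nb t h hadj)
      · exact absurd hadj (hbY t h).2)
    hc
  refine hNC _ _ w _ hw hole hu ?_ ?_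
  swap
  · refine ⟨q, b, q', hqq, he, he', ?_, ?_⟩
    · simp [Sym2.eq_swap]
    · simp [Walk.edges_concat, Sym2.eq_swap]
  · intro h
    simp only [Walk.support_cons, Walk.support_concat, List.mem_cons,
      List.mem_append, List.not_mem_nil, or_false] at h
    have : u ∈ P.support := by tauto
    rcases hP u this with ((h | h) | h)
    · exact hL.hu h
    · exact hR.hu h
    · exact huY h

/-- For a vertex missing `b`, one side of the hole is missed. -/
lemma exists_missed_side {G : SimpleGraph V} {a u b v : V} {w : G.Walk a a}
    (hNC : VertexNC G u) (hw : IsHole G w) (hu : u ∈ w.support) (hb : b ∈ w.support)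
    (hub : u ≠ b) (hnub : ¬ G.Adj u b) (hvu : u ≠ v) (hvb : v ≠ b) (hnvb : ¬ G.Adj b v) :
    ∃ L p q, IsSide G u b p q L ∧ ∀ x ∈ L, x ≠ v ∧ ¬ G.Adj x v := by
  obtain ⟨L, R, p, q, p', q', hL, hR, h1, h2, h3, h4⟩ := hole_split hw hu hb hub hnub
  by_cases tL : ∃ x ∈ L, ∃ z ∈ ({v} : Set V), x = z ∨ G.Adj x z
  · by_cases tR : ∃ x ∈ R, ∃ z ∈ ({v} : Set V), x = z ∨ G.Adj x z
    · exact (misses_side hNC hw hu hL hR h1 h2 h3 h4 hub (Y := {v}) (y := v)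
        (by rintro x rfl; exact ConnIn.refl rfl) (by simpa using hvu)
        (by rintro x rfl; exact ⟨hvb, hnvb⟩) tL tR).elim
    · refine ⟨R, p', q', hR, fun x hx => ⟨fun h => tR ⟨x, hx, v, rfl, Or.inl h⟩,
        fun h => tR ⟨x, hx, v, rfl, Or.inr h⟩⟩⟩
  · refine ⟨L, p, q, hL, fun x hx => ⟨fun h => tL ⟨x, hx, v, rfl, Or.inl h⟩,
        fun h => tL ⟨x, hx, v, rfl, Or.inr h⟩⟩⟩

/-- `x` lies on a hole of `G` containing `u`. -/
def CoHole (G : SimpleGraph V) (u x : V) : Prop :=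
  ∃ (a : V) (w : G.Walk a a), IsHole G w ∧ u ∈ w.support ∧ x ∈ w.support

lemma touch_side {G : SimpleGraph V} {u a b p q p2 : V} {L Y : Set V}
    (hL : IsSide G u b p q L) (hub : u ≠ b) (hnub : ¬ G.Adj u b)
    (hY : ∀ x ∈ Y, ConnIn G Y a x) (haY : a ∈ Y) (hp2 : p2 ∈ Y) (hup2 : G.Adj u p2)
    (nY : ∀ x ∈ Y, G.Adj u x → x = p2) (huY : u ∉ Y)
    (hbY : ∀ x ∈ Y, x ≠ b ∧ ¬ G.Adj b x) (P : G.Walk a b)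
    (hP : ∀ z ∈ P.support, z ≠ a → z ≠ b → z ≠ u ∧ ¬ G.Adj u z ∧ ¬ CoHole G u z) :
    ∃ x ∈ L, ∃ z ∈ Y, x = z ∨ G.Adj x z := by
  by_contra hcon
  push Not at hcon
  set Z : Set V := {z | z ∈ P.support ∧ z ≠ a ∧ z ≠ b} with hZ
  set S : Set V := (L ∪ {b}) ∪ (Z ∪ Y) with hS
  have sL : L ⊆ S := fun t ht => Or.inl (Or.inl ht)
  have sb : b ∈ S := Or.inl (Or.inr rfl)
  have sY : Y ⊆ S := fun t ht => Or.inr (Or.inr ht)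
  have hPS : ∀ z ∈ P.support, z ∈ S := by
    intro z hz
    by_cases h1 : z = a
    · exact h1 ▸ sY haY
    by_cases h2 : z = b
    · exact h2 ▸ sb
    exact Or.inr (Or.inl ⟨hz, h1, h2⟩)
  have hc : ConnIn G S p p2 :=
    ((((hL.conn q hL.hq).mono sL).trans (ConnIn.of_adj (sL hL.hq) sb hL.qb)).trans
      (ConnIn.symm ⟨P, hPS⟩)).trans ((hY p2 hp2).mono sY)
  have hpp := hcon p hL.hp p2 hp2
  obtain ⟨Q, hQ, hole⟩ := exists_hole hL.up hup2.symm hpp.1 hpp.2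
    (by
      rintro ((h | h) | (h | h))
      · exact hL.hu h
      · exact hub h
      · exact (hP u h.1 h.2.1 h.2.2).1 rfl
      · exact huY h)
    (by
      rintro t ((h | h) | (h | h)) hadj
      · exact Or.inl (hL.nu t h hadj)
      · rw [Set.mem_singleton_iff] at h
        exact absurd (h ▸ hadj) hnub
      · exact absurd hadj (hP t h.1 h.2.1 h.2.2).2.1
      · exact Or.inr (nY t h hadj))
    hc
  obtain ⟨d, hd, hd1, hd2⟩ := Q.exists_boundary_dart (L ∪ {b}) (Or.inl hL.hp) (by
    rintro (h | h)
    · exact (hcon p2 h p2 hp2).1 rfl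
    · exact (hbY p2 hp2).1 h)
  have hdQ : d.snd ∈ Q.support := Q.dart_snd_mem_support_of_mem_darts hd
  rcases hQ _ hdQ with h | h | h
  · exact hd2 h
  · refine (hP _ h.1 h.2.1 h.2.2).2.2 ⟨_, _, hole, by simp, ?_⟩
    simp [Walk.support_concat, hdQ]
  · rcases hd1 with h1 | h1
    · exact (hcon _ h1 _ h).2 d.adj
    · rw [Set.mem_singleton_iff] at h1
      exact (hbY _ h).2 (h1 ▸ d.adj)

lemma step_core {G : SimpleGraph V} {u a b : V} (hNC : VertexNC G u)
    (hub : u ≠ b) (hnub : ¬ G.Adj u b) (hb : CoHole G u b) (hua : u ≠ a) (hab : a ≠ b)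
    (hnab : ¬ G.Adj a b) (ha : G.Adj u a ∨ CoHole G u a) (P : G.Walk a b)
    (hP : ∀ z ∈ P.support, z ≠ a → z ≠ b → z ≠ u ∧ ¬ G.Adj u z ∧ ¬ CoHole G u z) : False := by
  obtain ⟨Y, p2, hY, haY, hp2, hup2, nY, huY, hbY⟩ : ∃ (Y : Set V) (p2 : V),
      (∀ x ∈ Y, ConnIn G Y a x) ∧ a ∈ Y ∧ p2 ∈ Y ∧ G.Adj u p2 ∧
      (∀ x ∈ Y, G.Adj u x → x = p2) ∧ u ∉ Y ∧ (∀ x ∈ Y, x ≠ b ∧ ¬ G.Adj b x) := by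
    by_cases hadj : G.Adj u a
    · refine ⟨{a}, a, ?_, rfl, rfl, hadj, ?_, by simpa using hua, ?_⟩
      · rintro x rfl; exact ConnIn.refl rfl
      · rintro x rfl _; rfl
      · rintro x rfl; exact ⟨hab, fun h => hnab h.symm⟩
    · obtain ⟨c, w, hw, huw, haw⟩ := ha.resolve_left hadj
      obtain ⟨L, p, q, hL, hmiss⟩ := exists_missed_side (v := b) hNC hw huw haw hua hadj
        hub hab.symm hnab
      have sL : L ⊆ insert a L := fun t ht => Or.inr ht
      refine ⟨insert a L, p, ?_, Or.inl rfl, Or.inr hL.hp, hL.up, ?_, ?_, ?_⟩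
      · rintro x (rfl | hx)
        · exact ConnIn.refl (Or.inl rfl)
        · exact ((ConnIn.of_adj (sL hL.hq) (Or.inl rfl) hL.qb).symm.trans
            ((hL.conn q hL.hq).mono sL).symm).trans ((hL.conn x hx).mono sL)
      · rintro x (rfl | hx) h
        · exact absurd h hadj
        · exact hL.nu x hx h
      · rintro (h | h)
        · exact hua h
        · exact hL.hu h
      · rintro x (rfl | hx)
        · exact ⟨hab, fun h => hnab h.symm⟩
        · exact ⟨(hmiss x hx).1, fun h => (hmiss x hx).2 h.symm⟩
  obtain ⟨c, w, hw, huw, hbw⟩ := hb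
  obtain ⟨L, R, p, q, p', q', hL, hR, h1, h2, h3, h4⟩ := hole_split hw huw hbw hub hnub
  exact misses_side hNC hw huw hL hR h1 h2 h3 h4 hub hY huY hbY
    (touch_side hL hub hnub hY haY hp2 hup2 nY huY hbY P hP)
    (touch_side hR hub hnub hY haY hp2 hup2 nY huY hbY P hP)

lemma localChordalize_adj {G : SimpleGraph V} {u x y : V} :
    (localChordalize G u).Adj x y ↔ G.Adj x y ∨
      (x ≠ y ∧ ((x = u ∧ CoHole G u y) ∨ (y = u ∧ CoHole G u x))) := by
  simp only [localChordalize, SimpleGraph.sup_adj, SimpleGraph.fromRel_adj, CoHole]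

lemma localChordalize_adj_self {G : SimpleGraph V} {u y : V} :
    (localChordalize G u).Adj u y ↔ G.Adj u y ∨ (u ≠ y ∧ CoHole G u y) := by
  rw [localChordalize_adj]
  constructor
  · rintro (h | ⟨h1, ⟨_, h2⟩ | ⟨h2, h3⟩⟩)
    · exact Or.inl h
    · exact Or.inr ⟨h1, h2⟩
    · exact absurd h2.symm h1
  · rintro (h | ⟨h1, h2⟩)
    · exact Or.inl h
    · exact Or.inr ⟨h1, Or.inl ⟨rfl, h2⟩⟩

lemma localChordalize_adj_of_ne {G : SimpleGraph V} {u x y : V} (hx : x ≠ u) (hy : y ≠ u) :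
    (localChordalize G u).Adj x y ↔ G.Adj x y := by
  rw [localChordalize_adj]; tauto

/-- No hole of the local chordalization contains `u`. -/
lemma no_hole_through {G : SimpleGraph V} {u a : V} (hNC : VertexNC G u)
    (w : (localChordalize G u).Walk a a) (hw : IsHole (localChordalize G u) w) :
    u ∉ w.support := by
  intro hu
  obtain ⟨n, c, hn, h0, hcn, hadj, hedge, hinj, hsup, hind⟩ := hole_index hw hu
  have hne : ∀ i, 0 < i → i < n → c i ≠ u := by
    intro i h1 h2 h
    have := hinj i 0 h2 (by omega) (h.trans h0.symm)
    omega
  -- the connection in `G` from `c 1` to `c (n-1)`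
  have hconn : ConnIn G {x | ∃ i, 0 < i ∧ i < n ∧ c i = x} (c 1) (c (n - 1)) := by
    have := connIn_interval (G := G) (S := {x | ∃ i, 0 < i ∧ i < n ∧ c i = x})
      (fun i => c (i + 1)) (n - 2)
      (fun i hi => (localChordalize_adj_of_ne (hne _ (by omega) (by omega))
        (hne _ (by omega) (by omega))).1 (hadj (i + 1) (by omega))) 0 (n - 2) (by omega) le_rfl
      (fun k hk1 hk2 => ⟨k + 1, by omega, by omega, rfl⟩)
    simpa [show n - 2 + 1 = n - 1 by omega] using this
  obtain ⟨P, hP⟩ := hconn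
  have hn1 : c 1 ≠ c (n - 1) := by
    intro h
    have := hinj _ _ (by omega) (by omega) h
    omega
  have hn2 : ¬ G.Adj (c 1) (c (n - 1)) := by
    intro h
    have := hind 1 (n - 1) (by omega) (by omega)
      (localChordalize_adj.2 (Or.inl h))
    omega
  have hA : (localChordalize G u).Adj u (c 1) := by
    rw [← h0]; rw [h0]; simpa [h0] using hadj 0 (by omega)
  have hB : (localChordalize G u).Adj u (c (n - 1)) := by
    have := hadj (n - 1) (by omega)
    rw [show n - 1 + 1 = n by omega, hcn] at this
    exact this.symm
  have hZ : ∀ z ∈ P.support, z ≠ c 1 → z ≠ c (n - 1) →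
      z ≠ u ∧ ¬ G.Adj u z ∧ ¬ CoHole G u z := by
    intro z hz h1 h2
    obtain ⟨i, hi1, hi2, rfl⟩ := hP z hz
    have h3 : ¬ (localChordalize G u).Adj u (c i) := by
      intro h
      rw [← h0] at h
      have h' : (localChordalize G u).Adj (c 0) (c i) := by
        rw [h0] at h ⊢; exact h
      rcases hind 0 i hi1 hi2 h' with h | h
      · exact h1 (by rw [h])
      · exact h2 (by rw [h.2])
    have h4 := hne i hi1 hi2
    rw [localChordalize_adj_self] at h3
    push Not at h3
    exact ⟨h4, h3.1, h3.2 h4.symm⟩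
  have hu1 : u ≠ c 1 := (hne 1 (by omega) (by omega)).symm
  have hu2 : u ≠ c (n - 1) := (hne (n - 1) (by omega) (by omega)).symm
  rw [localChordalize_adj_self] at hA hB
  by_cases hB' : G.Adj u (c (n - 1))
  · by_cases hA' : G.Adj u (c 1)
    · -- both old
      obtain ⟨Q, hQ, hole⟩ := exists_hole (S := {x | x ∈ P.support}) hA' hB'.symm hn1 hn2
        (by
          intro h
          obtain ⟨i, h1, h2, h3⟩ := hP u h
          exact hne i h1 h2 h3)
        (by
          intro x hx hadj
          by_contra hcon
          push Not at hcon
          exact (hZ x hx hcon.1 hcon.2).2.1 hadj)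
        ⟨P, fun _ h => h⟩
      obtain ⟨d, hd, hd1, hd2⟩ := Q.exists_boundary_dart {c 1} rfl (fun h => hn1 h.symm)
      have hdQ : d.snd ∈ Q.support := Q.dart_snd_mem_support_of_mem_darts hd
      have hdn : d.snd ≠ c (n - 1) := by
        intro h
        have := d.adj
        rw [h, Set.mem_singleton_iff.1 hd1] at this
        exact hn2 this
      refine (hZ d.snd (hQ _ hdQ) hd2 hdn).2.2 ⟨_, _, hole, by simp, ?_⟩
      simp [Walk.support_concat, hdQ]
    · refine step_core hNC hu1 hA' (hA.resolve_left hA').2 hu2 hn1.symm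
        (fun h => hn2 h.symm) (Or.inl hB') P.reverse ?_
      intro z hz h1 h2
      rw [Walk.support_reverse, List.mem_reverse] at hz
      exact hZ z hz h2 h1
  · exact step_core hNC hu2 hB' (hB.resolve_left hB').2 hu1 hn1 hn2
      (hA.imp id And.right) P hZ

lemma hole_transfer {G G' : SimpleGraph V} {a : V} (w : G.Walk a a) (hw : IsHole G w)
    (h : ∀ x ∈ w.support, ∀ y ∈ w.support, (G.Adj x y ↔ G'.Adj x y)) :
    ∃ w' : G'.Walk a a, IsHole G' w' ∧ w'.support = w.support ∧ w'.edges = w.edges := by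
  have he : ∀ e ∈ w.edges, e ∈ G'.edgeSet := by
    intro e he
    induction e using Sym2.ind with
    | _ x y =>
      exact (h x (w.fst_mem_support_of_mem_edges he) y (w.snd_mem_support_of_mem_edges he)).1
        (w.adj_of_mem_edges he)
  refine ⟨w.transfer G' he, ⟨hw.1.transfer he, ?_, ?_⟩, ?_, ?_⟩
  · rw [Walk.length_transfer]; exact hw.2.1
  · intro x y hx hy hxy
    rw [Walk.support_transfer] at hx hy
    rw [Walk.edges_transfer]
    exact hw.2.2 x y hx hy ((h x hx y hy).2 hxy)
  · rw [Walk.support_transfer]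
  · rw [Walk.edges_transfer]

lemma hole_back {G : SimpleGraph V} {u a : V} (hNC : VertexNC G u)
    (w : (localChordalize G u).Walk a a) (hw : IsHole (localChordalize G u) w) :
    ∃ w' : G.Walk a a, IsHole G w' ∧ w'.support = w.support ∧ w'.edges = w.edges := by
  have hu := no_hole_through hNC w hw
  exact hole_transfer w hw fun x hx y hy =>
    localChordalize_adj_of_ne (fun h => hu (h ▸ hx)) (fun h => hu (h ▸ hy))

lemma hole_forward {G : SimpleGraph V} {u a : V} (w : G.Walk a a) (hw : IsHole G w)
    (hu : u ∉ w.support) :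
    ∃ w' : (localChordalize G u).Walk a a, IsHole (localChordalize G u) w' ∧
      w'.support = w.support ∧ w'.edges = w.edges :=
  hole_transfer w hw fun x hx y hy =>
    (localChordalize_adj_of_ne (fun h : x = u => hu (h ▸ hx)) (fun h : y = u => hu (h ▸ hy))).symm

lemma chordalizeList_adj (l : List V) : ∀ (G : SimpleGraph V), l.Nodup →
    SetNC G {v | v ∈ l} → ∀ x y, (chordalizeList G l).Adj x y ↔
      G.Adj x y ∨ (x ≠ y ∧ ((x ∈ l ∧ CoHole G x y) ∨ (y ∈ l ∧ CoHole G y x))) := by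
  induction l with
  | nil => intro G _ _ x y; simp [chordalizeList]
  | cons u l ih =>
    intro G hnd hNC x y
    have hu : VertexNC G u := hNC.1 u (by simp)
    have hul : u ∉ l := (List.nodup_cons.1 hnd).1
    have hNC' : SetNC (localChordalize G u) {v | v ∈ l} := by
      constructor
      · intro v hv a b w₁ w₂ h₁ h₂ hv1 hv2
        obtain ⟨w₁', h₁', s1, e1⟩ := hole_back hu w₁ h₁
        obtain ⟨w₂', h₂', s2, e2⟩ := hole_back hu w₂ h₂
        rw [← e1, ← e2]
        exact hNC.1 v (List.mem_cons_of_mem _ hv) a b w₁' w₂' h₁' h₂' (s1 ▸ hv1) (s2 ▸ hv2)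
      · intro a w hw v hv v' hv' h1 h2
        obtain ⟨w', h', s, e⟩ := hole_back hu w hw
        exact hNC.2 a w' h' v (List.mem_cons_of_mem _ hv) v' (List.mem_cons_of_mem _ hv')
          (s ▸ h1) (s ▸ h2)
    have hco : ∀ v ∈ l, ∀ z, CoHole (localChordalize G u) v z ↔ CoHole G v z := by
      intro v hv z
      constructor
      · rintro ⟨a, w, hw, h1, h2⟩
        obtain ⟨w', h', s, e⟩ := hole_back hu w hw
        exact ⟨a, w', h', s ▸ h1, s ▸ h2⟩
      · rintro ⟨a, w, hw, h1, h2⟩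
        have huw : u ∉ w.support := by
          intro h
          have := hNC.2 a w hw u (by simp) v (List.mem_cons_of_mem _ hv) h h1
          exact hul (this ▸ hv)
        obtain ⟨w', h', s, e⟩ := hole_forward w hw huw
        exact ⟨a, w', h', s ▸ h1, s ▸ h2⟩
    rw [chordalizeList, ih _ (List.nodup_cons.1 hnd).2 hNC', localChordalize_adj]
    have e1 : (x ∈ l ∧ CoHole (localChordalize G u) x y) ↔ (x ∈ l ∧ CoHole G x y) :=
      and_congr_right fun h => hco x h y
    have e2 : (y ∈ l ∧ CoHole (localChordalize G u) y x) ↔ (y ∈ l ∧ CoHole G y x) :=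
      and_congr_right fun h => hco y h x
    have e3 : (x = u ∧ CoHole G u y) ↔ (x = u ∧ CoHole G x y) :=
      and_congr_right fun h => by rw [h]
    have e4 : (y = u ∧ CoHole G u x) ↔ (y = u ∧ CoHole G y x) :=
      and_congr_right fun h => by rw [h]
    rw [e1, e2, e3, e4, List.mem_cons, List.mem_cons, or_and_right, or_and_right]
    clear e1 e2 e3 e4 hco hNC' ih
    generalize (x = u ∧ CoHole G x y) = A1
    generalize (y = u ∧ CoHole G y x) = A2
    generalize (x ∈ l ∧ CoHole G x y) = A3
    generalize (y ∈ l ∧ CoHole G y x) = A4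
    generalize G.Adj x y = A5
    generalize (x ≠ y) = A6
    clear hnd hNC hu hul
    tauto

/-- Two adjacent cover vertices cannot both be joined to a common vertex by new edges. -/
lemma no_common {G : SimpleGraph V} {C : Set V} (hNC : SetNC G C) {u v x : V} (hu : u ∈ C)
    (hv : v ∈ C) (huv : G.Adj u v) (hux : u ≠ x) (hvx : v ≠ x) (hnux : ¬ G.Adj u x)
    (hnvx : ¬ G.Adj v x) (h1 : CoHole G u x) (h2 : CoHole G v x) : False := by
  obtain ⟨a1, w1, hw1, hu1, hx1⟩ := h1
  obtain ⟨a2, w2, hw2, hv2, hx2⟩ := h2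
  obtain ⟨A, p, q, hA, mA⟩ := exists_missed_side (v := v) (hNC.1 u hu) hw1 hu1 hx1 hux hnux
    huv.ne hvx (fun h => hnvx h.symm)
  obtain ⟨B, p', q', hB, mB⟩ := exists_missed_side (v := u) (hNC.1 v hv) hw2 hv2 hx2 hvx hnvx
    huv.ne.symm hux (fun h => hnux h.symm)
  set S : Set V := ({v} ∪ B) ∪ ({x} ∪ A) with hS
  have sv : v ∈ S := Or.inl (Or.inl rfl)
  have sB : B ⊆ S := fun t ht => Or.inl (Or.inr ht)
  have sx : x ∈ S := Or.inr (Or.inl rfl)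
  have sA : A ⊆ S := fun t ht => Or.inr (Or.inr ht)
  have hc : ConnIn G S v p :=
    ((((ConnIn.of_adj sv (sB hB.hp) hB.up).trans ((hB.conn q' hB.hq).mono sB)).trans
      (ConnIn.of_adj (sB hB.hq) sx hB.qb)).trans
      (ConnIn.of_adj (sA hA.hq) sx hA.qb).symm).trans ((hA.conn q hA.hq).mono sA).symm
  obtain ⟨Q, hQ, hole⟩ := exists_hole huv hA.up.symm (mA p hA.hp).1.symm
    (fun h => (mA p hA.hp).2 h.symm)
    (by
      rintro ((h | h) | (h | h))
      · exact huv.ne h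
      · exact (mB u h).1 rfl
      · exact hux h
      · exact hA.hu h)
    (by
      rintro t ((h | h) | (h | h)) hadj
      · exact Or.inl h
      · exact absurd hadj.symm (mB t h).2
      · rw [Set.mem_singleton_iff] at h
        exact absurd (h ▸ hadj) hnux
      · exact Or.inr (hA.nu t h hadj))
    hc
  exact huv.ne (hNC.2 _ _ hole u hu v hv (by simp) (by simp [Walk.support_concat]))

/-- A 4-cycle without chords is a hole. -/
lemma four_hole {G : SimpleGraph V} {u v x y : V} (h1 : G.Adj u v) (h2 : G.Adj v x)
    (h3 : G.Adj x y) (h4 : G.Adj y u) (h5 : ¬ G.Adj u x) (h6 : ¬ G.Adj v y) (h7 : v ≠ y)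
    (h8 : u ≠ x) : ∃ (a : V) (w : G.Walk a a), IsHole G w ∧ u ∈ w.support ∧ v ∈ w.support := by
  obtain ⟨Q, hQ, hole⟩ := exists_hole (S := {v, x, y}) h1 h4 h7 h6
    (by simp only [Set.mem_insert_iff, Set.mem_singleton_iff, not_or]
        exact ⟨h1.ne, h8, h4.ne.symm⟩)
    (by
      rintro t (h | h | h) hadj
      · exact Or.inl h
      · exact absurd (h ▸ hadj) h5
      · exact Or.inr h)
    ((ConnIn.of_adj (by simp) (by simp) h2).trans (ConnIn.of_adj (by simp) (by simp) h3))
  exact ⟨_, _, hole, by simp, by simp [Walk.support_concat]⟩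

lemma new_edge {G : SimpleGraph V} {l : List V} (hl : l.Nodup) (hNC : SetNC G {v | v ∈ l})
    {x y : V} (h : (chordalizeList G l).Adj x y) (hn : ¬ G.Adj x y) :
    x ≠ y ∧ ((x ∈ l ∧ CoHole G x y) ∨ (y ∈ l ∧ CoHole G y x)) :=
  ((chordalizeList_adj l G hl hNC x y).1 h).resolve_left hn

lemma coHole_not_mem {G : SimpleGraph V} {C : Set V} (hNC : SetNC G C) {u x : V} (hu : u ∈ C)
    (hux : u ≠ x) (h : CoHole G u x) : x ∉ C := by
  intro hx
  obtain ⟨a, w, hw, h1, h2⟩ := h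
  exact hux (hNC.2 a w hw u hu x hx h1 h2)

/-- The two-new-edges configuration is impossible in a clique. -/
lemma no_two_new {G : SimpleGraph V} {l : List V} (hl : l.Nodup) (hNC : SetNC G {v | v ∈ l})
    {K : Set V} (hK : (chordalizeList G l).IsClique K) {u v x y : V}
    (hu : u ∈ l) (hv : v ∈ l) (huK : u ∈ K) (hvK : v ∈ K) (hxK : x ∈ K) (hyK : y ∈ K)
    (huv : u ≠ v) (hux : u ≠ x) (hvy : v ≠ y) (hnux : ¬ G.Adj u x) (hnvy : ¬ G.Adj v y)
    (h1 : CoHole G u x) (h2 : CoHole G v y) : False := by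
  have hx : x ∉ l := coHole_not_mem hNC hu hux h1
  have hy : y ∉ l := coHole_not_mem hNC hv hvy h2
  have hvx : v ≠ x := fun h => hx (h ▸ hv)
  have huy : u ≠ y := fun h => hy (h ▸ hu)
  have auv : G.Adj u v := by
    by_contra hn
    rcases (new_edge hl hNC (hK huK hvK huv) hn).2 with h | h
    · exact coHole_not_mem hNC hu huv h.2 hv
    · exact coHole_not_mem hNC hv huv.symm h.2 hu
  by_cases huy' : G.Adj u y
  · by_cases hvx' : G.Adj v x
    · have hxy : x ≠ y := by rintro rfl; exact hnux huy'
      have axy : G.Adj x y := by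
        by_contra hn
        rcases (new_edge hl hNC (hK hxK hyK hxy) hn).2 with h | h
        · exact hx h.1
        · exact hy h.1
      obtain ⟨a, w, hw, ha, hb⟩ := four_hole auv hvx' axy huy'.symm hnux hnvy hvy hux
      exact huv (hNC.2 a w hw u hu v hv ha hb)
    · rcases (new_edge hl hNC (hK hvK hxK hvx) hvx').2 with h | h
      · exact no_common hNC hu hv auv hux hvx hnux hvx' h1 h.2
      · exact hx h.1
  · rcases (new_edge hl hNC (hK huK hyK huy) huy').2 with h | h
    · exact no_common hNC hu hv auv huy hvy huy' hnvy h.2 h2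
    · exact hy h.1

lemma clique_structure {G : SimpleGraph V} {l : List V} (hl : l.Nodup)
    (hNC : SetNC G {v | v ∈ l}) {K : Set V} (hK : (chordalizeList G l).IsClique K) :
    G.IsClique K ∨ ∃ u ∈ l, u ∈ K ∧ G.IsClique (K \ {u}) := by
  by_contra hcon
  push Not at hcon
  obtain ⟨hKG, hcon⟩ := hcon
  have get : ∀ T : Set V, T ⊆ K → ¬ G.IsClique T → ∃ u x, u ∈ l ∧ u ∈ T ∧ x ∈ T ∧ u ≠ x ∧
      ¬ G.Adj u x ∧ CoHole G u x := by
    intro T hT hn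
    rw [SimpleGraph.isClique_iff, Set.Pairwise] at hn
    push Not at hn
    obtain ⟨x, hx, y, hy, hxy, hna⟩ := hn
    rcases (new_edge hl hNC (hK (hT hx) (hT hy) hxy) hna).2 with h | h
    · exact ⟨x, y, h.1, hx, hy, hxy, hna, h.2⟩
    · exact ⟨y, x, h.1, hy, hx, hxy.symm, fun h => hna h.symm, h.2⟩
  obtain ⟨u, x, hu, huK, hxK, hux, hnux, h1⟩ := get K subset_rfl hKG
  obtain ⟨v, y, hv, hvK, hyK, hvy, hnvy, h2⟩ := get (K \ {u}) Set.sdiff_subset (hcon u hu huK)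
  exact no_two_new hl hNC hK hu hv huK hvK.1 hxK hyK.1 (fun h => hvK.2 h.symm) hux hvy hnux hnvy
    h1 h2

/-- `ω(Ĝ(C)) ≤ ω(G) + 1`, with equality iff some `u ∈ C` has
`((⋃ holes through u) ∪ N_G(u)) \ {u}` containing a maximum clique of `G`. -/
theorem stmt8 {V : Type*} [Fintype V] [DecidableEq V] (G : SimpleGraph V) (C : Set V)
    (hcov : IsHoleCover G C) (hNC : SetNC G C)
    (l : List V) (hl : l.Nodup) (hlC : {v | v ∈ l} = C) :
    (chordalizeList G l).cliqueNum ≤ G.cliqueNum + 1 ∧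
      ((chordalizeList G l).cliqueNum = G.cliqueNum + 1 ↔
        ∃ u ∈ C, ∃ K : Finset V, G.IsNClique G.cliqueNum K ∧
          ↑K ⊆ (({x | ∃ (a : V) (w : G.Walk a a),
              IsHole G w ∧ u ∈ w.support ∧ x ∈ w.support} ∪ G.neighborSet u) \ {u})) := by
  subst hlC
  obtain ⟨K, hK⟩ := (chordalizeList G l).exists_isNClique_cliqueNum
  have hstruct := clique_structure hl hNC hK.isClique
  have hle : (chordalizeList G l).cliqueNum ≤ G.cliqueNum + 1 := by
    rw [← hK.card_eq]
    rcases hstruct with h | ⟨u, hu, huK, h⟩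
    · exact (h.card_le_cliqueNum).trans (Nat.le_succ _)
    · rw [← Finset.coe_singleton, ← Finset.coe_sdiff] at h
      have h2 := h.card_le_cliqueNum
      rw [Finset.sdiff_singleton_eq_erase, Finset.card_erase_of_mem huK] at h2
      omega
  refine ⟨hle, ?_, ?_⟩
  · intro heq
    rcases hstruct with h | ⟨u, hu, huK, h⟩
    · have := h.card_le_cliqueNum
      rw [hK.card_eq] at this
      omega
    · rw [← Finset.coe_singleton, ← Finset.coe_sdiff, Finset.sdiff_singleton_eq_erase] at h
      refine ⟨u, hu, K.erase u, ⟨h, ?_⟩, ?_⟩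
      · rw [Finset.card_erase_of_mem huK, hK.card_eq]; omega
      · intro x hx
        rw [Finset.mem_coe, Finset.mem_erase] at hx
        refine ⟨?_, hx.1⟩
        by_cases hadj : G.Adj u x
        · exact Or.inr hadj
        · left
          rcases (new_edge hl hNC (hK.isClique huK hx.2 hx.1.symm) hadj).2 with h' | h'
          · exact h'.2
          · obtain ⟨a, w, hw, h1, h2⟩ := h'.2
            exact ⟨a, w, hw, h2, h1⟩
  · rintro ⟨u, hu, M, hM, hsub⟩
    refine le_antisymm hle ?_
    have huM : u ∉ M := fun h => (hsub h).2 rfl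
    have hcl : (chordalizeList G l).IsClique (insert u M : Finset V) := by
      rw [Finset.coe_insert, SimpleGraph.isClique_insert]
      refine ⟨fun x hx y hy hxy =>
        (chordalizeList_adj l G hl hNC x y).2 (Or.inl (hM.isClique hx hy hxy)), ?_⟩
      intro x hx hux
      rw [chordalizeList_adj l G hl hNC]
      rcases (hsub hx).1 with h | h
      · exact Or.inr ⟨hux, Or.inl ⟨hu, h⟩⟩
      · exact Or.inl h
    have := hcl.card_le_cliqueNum
    rw [Finset.card_insert_of_notMem huM, hM.card_eq] at this
    exact this
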